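/- arXiv:2103.04483 — 4 statements merged into one kernel-verified Lean document; each statement's English description precedes it below -/
import Mathlib

section
/- Let p and q be distinct odd primes and let a and b be arbitrary integers. Set L = lcm(p·q, ord_p(2), ord_q(2)). Then the number of integers n with 0 ≤ n < L satisfying simultaneously n·2^n ≡ a (mod p) and n·2^n ≡ b (mod q) is exactly L/(p·q). -/
theorem cullen_aux_count (M r : ℕ) (hM : 0 < M) (hr : 0 < r) (h : Nat.Coprime M r)
    (P : ℕ → Prop) [DecidablePred P] (Q : ℕ → Prop) [DecidablePred Q] (c : ℕ → ZMod r)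
    (hP : ∀ n, P n ↔ P (n % M)) (hc : ∀ n, c n = c (n % M))
    (hQ : ∀ n, Q n ↔ (n : ZMod r) = c n) :
    ((Finset.range (M * r)).filter (fun n => P n ∧ Q n)).card
      = ((Finset.range M).filter P).card := by
  have : NeZero r := ⟨hr.ne'⟩
  apply Finset.card_bij (fun n _ => n % M)
  · intro n hn
    simp only [Finset.mem_filter, Finset.mem_range] at hn ⊢
    exact ⟨Nat.mod_lt _ hM, (hP n).1 hn.2.1⟩
  · intro n hn m hm e
    simp only [Finset.mem_filter, Finset.mem_range] at hn hm e
    have h1 : (n : ZMod r) = m := by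
      rw [(hQ n).1 hn.2.2, (hQ m).1 hm.2.2, hc n, hc m, e]
    have h2 : n ≡ m [MOD r] := (ZMod.natCast_eq_natCast_iff _ _ _).1 h1
    have h3 : n ≡ m [MOD M * r] := (Nat.modEq_and_modEq_iff_modEq_mul h).1 ⟨e, h2⟩
    exact Nat.ModEq.eq_of_lt_of_lt h3 hn.1 hm.1
  · intro m hm
    simp only [Finset.mem_filter, Finset.mem_range] at hm
    let k := Nat.chineseRemainder h m (c m).val
    have hk1 : (k : ℕ) % M = m := by
      have := k.2.1
      rwa [Nat.ModEq, Nat.mod_eq_of_lt hm.1] at this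
    refine ⟨k, ?_, hk1⟩
    simp only [Finset.mem_filter, Finset.mem_range]
    refine ⟨Nat.chineseRemainder_lt_mul h _ _ hM.ne' hr.ne', ?_, ?_⟩
    · rw [hP, hk1]; exact hm.2
    · rw [hQ, (hc k).trans (congrArg c hk1)]
      have := (ZMod.natCast_eq_natCast_iff _ _ _).2 k.2.2
      rw [this]; simp

theorem cullen_aux_periodic (m : ℕ) (P : ℕ → Prop) [DecidablePred P]
    (hP : ∀ n, P (m + n) ↔ P n) (k : ℕ) :
    ((Finset.range (m * k)).filter P).card = ((Finset.range m).filter P).card * k := by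
  simp only [← Nat.count_eq_card_filter_range]
  induction k with
  | zero => simp
  | succ k ih =>
    rw [Nat.mul_succ, Nat.add_comm, Nat.count_add]
    simp only [hP]
    rw [ih]; ring

theorem cullen_aux_pow {p : ℕ} (hp : p.Prime) (hp2 : p ≠ 2) :
    (2 : ZMod p) ≠ 0 ∧ 0 < orderOf (2 : ZMod p) ∧ orderOf (2 : ZMod p) < p := by
  have := Fact.mk hp
  have h0 : (2 : ZMod p) ≠ 0 := by
    intro h
    have : ((2 : ℕ) : ZMod p) = 0 := by exact_mod_cast h
    rw [ZMod.natCast_eq_zero_iff] at this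
    exact hp2 ((Nat.prime_dvd_prime_iff_eq hp Nat.prime_two).1 this)
  have hd := ZMod.orderOf_dvd_card_sub_one h0
  have := hp.two_le
  exact ⟨h0, Nat.pos_of_dvd_of_pos hd (by omega),
    lt_of_le_of_lt (Nat.le_of_dvd (by omega) hd) (by omega)⟩

theorem cullen_aux_iff {p : ℕ} (hp : p.Prime) (hp2 : p ≠ 2) (a : ZMod p) (n : ℕ) :
    (n : ZMod p) * 2 ^ n = a ↔ (n : ZMod p) = a * (2 ^ n)⁻¹ := by
  have := Fact.mk hp
  exact (eq_mul_inv_iff_mul_eq₀ (pow_ne_zero _ (cullen_aux_pow hp hp2).1)).symm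

theorem cullen_aux_mod {p : ℕ} (M : ℕ) (hM : orderOf (2 : ZMod p) ∣ M) (n : ℕ) :
    (2 : ZMod p) ^ n = 2 ^ (n % M) := by
  rw [← pow_mod_orderOf, ← pow_mod_orderOf (2 : ZMod p) (n % M), Nat.mod_mod_of_dvd _ hM]

theorem cullen_aux_one {p : ℕ} (hp : p.Prime) (hp2 : p ≠ 2) (a : ZMod p) (M : ℕ)
    (hpM : p ∣ M) (hM : orderOf (2 : ZMod p) ∣ M) :
    ((Finset.range M).filter (fun n : ℕ => (n : ZMod p) * (2 : ZMod p) ^ n = a)).card = M / p := by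
  obtain ⟨h0, hd, hlt⟩ := cullen_aux_pow hp hp2
  have hco : Nat.Coprime (orderOf (2 : ZMod p)) p :=
    ((hp.coprime_iff_not_dvd).2 (fun h => absurd (Nat.le_of_dvd hd h) (by omega))).symm
  obtain ⟨k, rfl⟩ := hco.mul_dvd_of_dvd_of_dvd hM hpM
  rw [cullen_aux_periodic]
  · have := cullen_aux_count (orderOf (2 : ZMod p)) p hd hp.pos hco (fun _ => True)
      (fun n : ℕ => (n : ZMod p) * (2 : ZMod p) ^ n = a) (fun n => a * (2 ^ n)⁻¹)
      (by simp) (fun n => by simp only [cullen_aux_mod _ dvd_rfl n])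
      (cullen_aux_iff hp hp2 a)
    simp only [true_and, Finset.filter_true, Finset.card_range] at this
    rw [this, mul_right_comm, Nat.mul_div_cancel _ hp.pos]
  · intro n
    simp [pow_add, pow_mul, pow_orderOf_eq_one]

theorem cullen_aux_lt (p q : ℕ) (hp : p.Prime) (hq : q.Prime)
    (hp2 : p ≠ 2) (hq2 : q ≠ 2) (hpq : p < q) (a : ZMod p) (b : ZMod q) :
    ((Finset.range (Nat.lcm (p * q) (Nat.lcm (orderOf (2 : ZMod p)) (orderOf (2 : ZMod q))))).filter
        (fun n : ℕ => (n : ZMod p) * (2 : ZMod p) ^ n = a ∧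
          (n : ZMod q) * (2 : ZMod q) ^ n = b)).card
      = Nat.lcm (p * q) (Nat.lcm (orderOf (2 : ZMod p)) (orderOf (2 : ZMod q))) / (p * q) := by
  obtain ⟨-, hd, hdl⟩ := cullen_aux_pow hp hp2
  obtain ⟨-, he, hel⟩ := cullen_aux_pow hq hq2
  set d := orderOf (2 : ZMod p) with hdd
  set e := orderOf (2 : ZMod q) with hee
  set M := Nat.lcm p (Nat.lcm d e) with hMM
  have cop : ∀ x, 0 < x → x < q → Nat.Coprime x q := fun x h1 h2 =>
    ((hq.coprime_iff_not_dvd).2 (fun h => absurd (Nat.le_of_dvd h1 h) (by omega))).symm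
  have cl : ∀ x y, Nat.Coprime x q → Nat.Coprime y q → Nat.Coprime (Nat.lcm x y) q :=
    fun x y h1 h2 => Nat.Coprime.coprime_dvd_left (Nat.lcm_dvd_mul x y) (Nat.Coprime.mul_left h1 h2)
  have hco : Nat.Coprime M q :=
    cl _ _ (cop _ hp.pos hpq) (cl _ _ (cop _ hd (hdl.trans hpq)) (cop _ he hel))
  have hMpos : 0 < M := Nat.lcm_pos hp.pos (Nat.lcm_pos hd he)
  have hpM : p ∣ M := Nat.dvd_lcm_left _ _
  have hdM : d ∣ M := (Nat.dvd_lcm_left d e).trans (Nat.dvd_lcm_right _ _)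
  have heM : e ∣ M := (Nat.dvd_lcm_right d e).trans (Nat.dvd_lcm_right _ _)
  have hL : Nat.lcm (p * q) (Nat.lcm d e) = M * q := by
    apply Nat.dvd_antisymm
    · exact Nat.lcm_dvd (Nat.mul_dvd_mul_right hpM q)
        ((Nat.dvd_lcm_right _ _).trans (Nat.dvd_mul_right M q))
    · apply hco.mul_dvd_of_dvd_of_dvd
      · exact Nat.lcm_dvd ((Nat.dvd_mul_right p q).trans (Nat.dvd_lcm_left _ _))
          (Nat.dvd_lcm_right _ _)
      · exact (Nat.dvd_mul_left q p).trans (Nat.dvd_lcm_left _ _)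
  rw [hL, Nat.mul_div_mul_right _ _ hq.pos, ← cullen_aux_one hp hp2 a M hpM hdM]
  refine cullen_aux_count M q hMpos hq.pos hco _ _ (fun n => b * (2 ^ n)⁻¹) ?_ ?_
    (cullen_aux_iff hq hq2 b)
  · intro n
    have h1 : ((n % M : ℕ) : ZMod p) = n := by
      rw [ZMod.natCast_eq_natCast_iff]
      exact (Nat.mod_modEq n M).of_dvd hpM
    rw [h1, ← cullen_aux_mod M hdM n]
  · intro n
    simp only [cullen_aux_mod M heM n]


/-- Let `p` and `q` be distinct odd primes and `a`, `b` arbitrary integers.  With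
`L = lcm(p*q, ord_p(2), ord_q(2))`, the number of `n` with `0 ≤ n < L` satisfying
`n·2^n ≡ a (mod p)` and `n·2^n ≡ b (mod q)` is exactly `L / (p*q)`. -/
theorem cullen_system_count (p q : ℕ) (hp : p.Prime) (hq : q.Prime)
    (hp2 : p ≠ 2) (hq2 : q ≠ 2) (hpq : p ≠ q) (a b : ℤ) :
    ((Finset.range (Nat.lcm (p * q) (Nat.lcm (orderOf (2 : ZMod p)) (orderOf (2 : ZMod q))))).filter
        (fun n : ℕ => (n : ZMod p) * (2 : ZMod p) ^ n = (a : ZMod p) ∧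
          (n : ZMod q) * (2 : ZMod q) ^ n = (b : ZMod q))).card
      = Nat.lcm (p * q) (Nat.lcm (orderOf (2 : ZMod p)) (orderOf (2 : ZMod q))) / (p * q) := by

  rcases lt_or_gt_of_ne hpq with h | h
  · exact cullen_aux_lt p q hp hq hp2 hq2 h a b
  · have := cullen_aux_lt q p hq hp hq2 hp2 h b a
    rw [mul_comm p q, Nat.lcm_comm (orderOf (2 : ZMod p)), ← this]
    congr 1
    ext n
    simp only [Finset.mem_filter, and_comm]
end

section
/- Let p be an odd prime and let a be any integer. Then the number of integers n with 0 ≤ n < p·ord_p(2) satisfying n·2^n ≡ a (mod p) is exactly ord_p(2). -/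
/-- Let `p` be an odd prime and `a` any integer.  The number of `n` with
`0 ≤ n < p·ord_p(2)` satisfying `n·2^n ≡ a (mod p)` is exactly `ord_p(2)`. -/
theorem cullen_congruence_count (p : ℕ) (hp : p.Prime) (hp2 : p ≠ 2) (a : ℤ) :
    ((Finset.range (p * orderOf (2 : ZMod p))).filter
        (fun n : ℕ => (n : ZMod p) * (2 : ZMod p) ^ n = (a : ZMod p))).card
      = orderOf (2 : ZMod p) := by
  have : Fact p.Prime := ⟨hp⟩
  have h2 : (2 : ZMod p) ≠ 0 := by
    intro h
    have h' : ((2 : ℕ) : ZMod p) = 0 := by exact_mod_cast h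
    rw [ZMod.natCast_eq_zero_iff] at h'
    exact hp2 ((Nat.prime_dvd_prime_iff_eq hp Nat.prime_two).1 h')
  have hd : orderOf (2 : ZMod p) ∣ p - 1 :=
    orderOf_dvd_of_pow_eq_one (ZMod.pow_card_sub_one_eq_one h2)
  have hp1 : 0 < p - 1 := by have := hp.two_le; omega
  have hpos : 0 < orderOf (2 : ZMod p) := Nat.pos_of_dvd_of_pos hd hp1
  have hle := Nat.le_of_dvd hp1 hd
  have hpow : ∀ m n : ℕ, m ≡ n [MOD orderOf (2 : ZMod p)] →
      (2 : ZMod p) ^ m = 2 ^ n := by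
    intro m n h
    rw [← pow_mod_orderOf, h, pow_mod_orderOf]
  have hco : Nat.Coprime p (orderOf (2 : ZMod p)) := by
    rw [hp.coprime_iff_not_dvd]
    intro h
    have := Nat.le_of_dvd hpos h
    omega
  generalize orderOf (2 : ZMod p) = T at *
  conv_rhs => rw [← Finset.card_range T]
  apply Finset.card_bij (fun n _ => n % T)
  · intro n _
    exact Finset.mem_range.2 (Nat.mod_lt _ hpos)
  · intro m hm n hn h
    simp only [Finset.mem_filter, Finset.mem_range] at hm hn
    have e := hm.2.trans hn.2.symm
    rw [hpow m n h] at e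
    have e' := mul_right_cancel₀ (pow_ne_zero _ h2) e
    rw [ZMod.natCast_eq_natCast_iff] at e'
    exact ((Nat.modEq_and_modEq_iff_modEq_mul hco).1 ⟨e', h⟩).eq_of_lt_of_lt hm.1 hn.1
  · intro k hk
    have hk' := Finset.mem_range.1 hk
    let r : ℕ := ((a : ZMod p) * ((2 : ZMod p) ^ k)⁻¹).val
    let c := Nat.chineseRemainder hco r k
    refine ⟨c.1, ?_, ?_⟩
    · simp only [Finset.mem_filter, Finset.mem_range]
      refine ⟨Nat.chineseRemainder_lt_mul hco r k hp.ne_zero hpos.ne', ?_⟩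
      rw [hpow _ _ c.2.2, (ZMod.natCast_eq_natCast_iff _ _ _).2 c.2.1]
      simp only [r, ZMod.natCast_val, ZMod.cast_id', id]
      rw [mul_assoc, inv_mul_cancel₀ (pow_ne_zero _ h2), mul_one]
    · exact Eq.trans c.2.2 (Nat.mod_eq_of_lt hk')
end

section
/- Let p be an odd prime and let n be an integer with 1 ≤ n ≤ p−2. If p divides n! + 1 or p divides n! − 1, then p divides exactly one of the two numbers (p−n−1)! + 1 and (p−n−1)! − 1. -/
theorem fact_aux (p : ℕ) [Fact p.Prime] (n : ℕ) : ∀ m : ℕ, n + m + 1 = p →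
    (n.factorial : ZMod p) * (m.factorial : ZMod p) = (-1) ^ (n + 1) := by
  induction n with
  | zero =>
    intro m hm
    have h := ZMod.wilsons_lemma p
    have e : p - 1 = m := by omega
    rw [e] at h
    simp [h]
  | succ n ih =>
    intro m hm
    have h := ih (m + 1) (by omega)
    have e : ((n + 1 + m + 1 : ℕ) : ZMod p) = 0 := by
      rw [hm]; exact ZMod.natCast_self p
    rw [Nat.factorial_succ] at h ⊢
    push_cast at h e ⊢
    rw [pow_succ, ← h]
    linear_combination (n.factorial : ZMod p) * (m.factorial : ZMod p) * e

/-- Let `p` be an odd prime and `n` an integer with `1 ≤ n ≤ p-2`.  If `p` divides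
`n! + 1` or `p` divides `n! - 1`, then `p` divides exactly one of
`(p-n-1)! + 1` and `(p-n-1)! - 1`. -/
theorem factorial_reflection (p n : ℕ) (hp : p.Prime) (hp2 : p ≠ 2)
    (hn1 : 1 ≤ n) (hn2 : n ≤ p - 2)
    (h : (p : ℤ) ∣ ((n.factorial : ℤ) + 1) ∨ (p : ℤ) ∣ ((n.factorial : ℤ) - 1)) :
    Xor' ((p : ℤ) ∣ (((p - n - 1).factorial : ℤ) + 1))
      ((p : ℤ) ∣ (((p - n - 1).factorial : ℤ) - 1)) := by
  haveI : Fact p.Prime := ⟨hp⟩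
  haveI : Fact (2 < p) := ⟨lt_of_le_of_ne hp.two_le (Ne.symm hp2)⟩
  have hne : (-1 : ZMod p) ≠ 1 := ZMod.neg_one_ne_one
  have key := fact_aux p n (p - n - 1) (by have := hp.two_le; omega)
  simp only [← ZMod.intCast_zmod_eq_zero_iff_dvd] at h ⊢
  push_cast at h ⊢
  generalize (n.factorial : ZMod p) = a at *
  generalize ((p - n - 1).factorial : ZMod p) = b at *
  have hb : b + 1 = 0 ∨ b - 1 = 0 := by
    rcases h with h | h <;> rcases neg_one_pow_eq_or (ZMod p) (n + 1) with e | e <;>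
      rw [e] at key
    · left; linear_combination b * h - key
    · right; linear_combination b * h - key
    · right; linear_combination key - b * h
    · left; linear_combination key - b * h
  have hnot : ¬ (b + 1 = 0 ∧ b - 1 = 0) := by
    rintro ⟨h1, h2⟩
    exact hne (by linear_combination h2 - h1)
  unfold Xor'
  tauto
end

section
/- For every real number s > 1, the prime zeta function satisfies P(s) = Σ_{k=1}^∞ (μ(k)/k)·log ζ(ks), where the series on the right converges. -/
lemma aux_log_zeta (t : ℝ) (ht : 1 < t) :
    HasSum (fun p : Nat.Primes => -Real.log (1 - ((p : ℕ) : ℝ) ^ (-t)))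
      (Real.log (∑' n : ℕ, (((n : ℝ) + 1) ^ t)⁻¹)) := by
  let f : ℕ →*₀ ℝ :=
    { toFun := fun n => (n : ℝ) ^ (-t)
      map_zero' := by
        rw [Nat.cast_zero, Real.zero_rpow (by linarith)]
      map_one' := by simp
      map_mul' := fun m n => by
        simp only [Nat.cast_mul]
        rw [Real.mul_rpow (by positivity) (by positivity)] }
  have hf : ∀ n : ℕ, f n = (n : ℝ) ^ (-t) := fun n => rfl
  have hsum : Summable f := by
    have : Summable (fun n : ℕ => (n : ℝ) ^ (-t)) := Real.summable_nat_rpow.2 (by linarith)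
    exact this
  have hnn : ∀ n, 0 ≤ f n := fun n => by rw [hf]; positivity
  have hZ : ∑' n, f n = ∑' n : ℕ, (((n : ℝ) + 1) ^ t)⁻¹ := by
    rw [hsum.tsum_eq_zero_add, map_zero, zero_add]
    refine tsum_congr fun n => ?_
    rw [hf, Real.rpow_neg (by positivity)]
    push_cast
    rfl
  have hpos : 0 < ∑' n, f n := by
    refine hsum.tsum_pos hnn 1 ?_
    simp
  have hP := EulerProduct.eulerProduct_completely_multiplicative_hasProd (f := f)
    (by simpa only [Real.norm_eq_abs] using hsum.abs)
  rw [← hZ]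
  have hlt : ∀ p : Nat.Primes, 0 < 1 - f p := fun p => by
    have : f p < 1 := by
      rw [hf]
      exact Real.rpow_lt_one_of_one_lt_of_neg (by exact_mod_cast p.2.one_lt) (by linarith)
    linarith
  have h2 := (Real.continuousAt_log hpos.ne').tendsto.comp hP
  unfold HasSum
  refine h2.congr fun S => ?_
  simp only [Function.comp]
  rw [Real.log_prod (fun p _ => (inv_pos.2 (hlt p)).ne')]
  refine Finset.sum_congr rfl fun p _ => ?_
  rw [Real.log_inv, hf]

lemma aux_bound (x : ℝ) (h0 : 0 ≤ x) (h1 : x ≤ 1 / 2) (k m : ℕ) :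
    ‖((ArithmeticFunction.moebius (k + 1) : ℝ) / ((k : ℝ) + 1)) *
      (x ^ ((k + 1) * (m + 1)) / ((m : ℝ) + 1))‖ ≤ x * ((1 / 2) ^ k * (1 / 2) ^ m) := by
  have hmu : |(ArithmeticFunction.moebius (k + 1) : ℝ)| ≤ 1 := by
    exact_mod_cast ArithmeticFunction.abs_moebius_le_one
  have ha : ‖(ArithmeticFunction.moebius (k + 1) : ℝ) / ((k : ℝ) + 1)‖ ≤ 1 := by
    rw [norm_div, Real.norm_eq_abs, Real.norm_of_nonneg (by positivity)]
    refine div_le_one_of_le₀ (hmu.trans ?_) (by positivity)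
    have : (0 : ℝ) ≤ k := by positivity
    linarith
  have hb : ‖x ^ ((k + 1) * (m + 1)) / ((m : ℝ) + 1)‖ ≤ x * ((1 / 2) ^ k * (1 / 2) ^ m) := by
    rw [Real.norm_of_nonneg (by positivity)]
    refine (div_le_self (by positivity) ?_).trans ?_
    · have : (0 : ℝ) ≤ m := by positivity
      linarith
    · calc x ^ ((k + 1) * (m + 1)) ≤ x ^ (k + m + 1) :=
            pow_le_pow_of_le_one h0 (by linarith) (by nlinarith [Nat.zero_le (k * m)])
        _ = x * (x ^ k * x ^ m) := by ring
        _ ≤ _ := by gcongr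
  rw [norm_mul]
  calc _ ≤ 1 * (x * ((1 / 2) ^ k * (1 / 2) ^ m)) := by gcongr
    _ = _ := one_mul _

lemma aux_geom : Summable (fun q : ℕ × ℕ => ((1 : ℝ) / 2) ^ q.1 * (1 / 2) ^ q.2) :=
  summable_geometric_two.mul_of_nonneg summable_geometric_two
    (fun _ => by positivity) (fun _ => by positivity)

lemma aux_inner (x : ℝ) (h0 : 0 ≤ x) (h1 : x ≤ 1 / 2) :
    HasSum (fun q : ℕ × ℕ => ((ArithmeticFunction.moebius (q.1 + 1) : ℝ) / ((q.1 : ℝ) + 1)) *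
      (x ^ ((q.1 + 1) * (q.2 + 1)) / ((q.2 : ℝ) + 1))) x := by
  have hs : Summable (fun q : ℕ × ℕ =>
      ((ArithmeticFunction.moebius (q.1 + 1) : ℝ) / ((q.1 : ℝ) + 1)) *
      (x ^ ((q.1 + 1) * (q.2 + 1)) / ((q.2 : ℝ) + 1))) :=
    Summable.of_norm_bounded (aux_geom.mul_left x) (fun q => aux_bound x h0 h1 q.1 q.2)
  let e : (Σ n : ℕ+, Nat.divisorsAntidiagonal n) ≃ ℕ × ℕ :=
    sigmaAntidiagonalEquivProd.trans (Equiv.pnatEquivNat.prodCongr Equiv.pnatEquivNat)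
  rw [← e.hasSum_iff]
  have hs' := e.summable_iff.2 hs
  have key : ∀ n : ℕ+, ∑' c : Nat.divisorsAntidiagonal n, (((fun q : ℕ × ℕ =>
      ((ArithmeticFunction.moebius (q.1 + 1) : ℝ) / ((q.1 : ℝ) + 1)) *
      (x ^ ((q.1 + 1) * (q.2 + 1)) / ((q.2 : ℝ) + 1))) ∘ e) ⟨n, c⟩) = if n = 1 then x else 0 := by
    intro n
    have h : ∀ c : Nat.divisorsAntidiagonal n, (((fun q : ℕ × ℕ =>
      ((ArithmeticFunction.moebius (q.1 + 1) : ℝ) / ((q.1 : ℝ) + 1)) *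
      (x ^ ((q.1 + 1) * (q.2 + 1)) / ((q.2 : ℝ) + 1))) ∘ e) ⟨n, c⟩) =
      (x ^ (n : ℕ) / (n : ℕ)) * (ArithmeticFunction.moebius c.1.1 : ℝ) := by
      rintro ⟨⟨a, b⟩, hc⟩
      have hc' := Nat.mem_divisorsAntidiagonal.1 hc
      have hn : a * b = n := hc'.1
      have hn0 : a * b ≠ 0 := by rw [hn]; exact hc'.2
      have ha : 0 < a := Nat.pos_of_ne_zero (left_ne_zero_of_mul hn0)
      have hb : 0 < b := Nat.pos_of_ne_zero (right_ne_zero_of_mul hn0)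
      have e1 : e ⟨n, ⟨(a, b), hc⟩⟩ = (a - 1, b - 1) := rfl
      have haR : (a : ℝ) ≠ 0 := by exact_mod_cast ha.ne'
      have hbR : (b : ℝ) ≠ 0 := by exact_mod_cast hb.ne'
      simp only [Function.comp, e1]
      rw [Nat.sub_add_cancel ha, Nat.sub_add_cancel hb, hn, Nat.cast_sub ha, Nat.cast_sub hb,
        ← hn]
      push_cast
      rw [sub_add_cancel, sub_add_cancel]
      field_simp
    rw [tsum_congr h, tsum_mul_left, tsum_fintype]
    have h3 : ∑ c : Nat.divisorsAntidiagonal n, (ArithmeticFunction.moebius c.1.1 : ℝ)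
        = if (n : ℕ) = 1 then 1 else 0 := by
      rw [Finset.sum_coe_sort (Nat.divisorsAntidiagonal n)
        (fun c => (ArithmeticFunction.moebius c.1 : ℝ))]
      have := congrArg (fun g : ArithmeticFunction ℤ => g n)
        ArithmeticFunction.moebius_mul_coe_zeta
      simp only [ArithmeticFunction.mul_apply, ArithmeticFunction.one_apply] at this
      have h4 : ∑ c ∈ Nat.divisorsAntidiagonal n, ArithmeticFunction.moebius c.1
          = if (n : ℕ) = 1 then 1 else 0 := by
        rw [← this]
        refine Finset.sum_congr rfl fun c hc => ?_
        have : c.2 ≠ 0 := by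
          intro h0
          have := Nat.mem_divisorsAntidiagonal.1 hc
          rw [h0, mul_zero] at this
          exact this.2 this.1.symm
        simp [ArithmeticFunction.zeta_apply, this]
      exact_mod_cast h4
    rw [h3]
    by_cases hn : n = 1
    · subst hn; simp
    · have : (n : ℕ) ≠ 1 := fun h => hn (PNat.coe_eq_one_iff.1 h)
      simp [hn]
  have hT := hs'.hasSum
  have h5 := hs'.tsum_sigma
  rw [tsum_congr key, tsum_ite_eq] at h5
  rwa [h5] at hT

/-- For every real `s > 1`, the prime zeta function `P(s) = Σ_p p^(-s)` satisfies
`P(s) = Σ_{k=1}^∞ (μ(k)/k)·log ζ(ks)`, where the series on the right converges.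
Here `ζ(x) = Σ_{n=1}^∞ n^(-x)` and `μ` is the Möbius function. -/
theorem prime_zeta_moebius_log_zeta (s : ℝ) (hs : 1 < s) :
    HasSum
      (fun k : ℕ => ((ArithmeticFunction.moebius (k + 1) : ℝ) / ((k : ℝ) + 1)) *
        Real.log (∑' n : ℕ, (((n : ℝ) + 1) ^ (((k : ℝ) + 1) * s))⁻¹))
      (∑' p : Nat.Primes, (((p : ℕ) : ℝ) ^ (-s)) ) := by
  have hx0 : ∀ p : Nat.Primes, 0 ≤ ((p : ℕ) : ℝ) ^ (-s) := fun p => by positivity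
  have hx1 : ∀ p : Nat.Primes, ((p : ℕ) : ℝ) ^ (-s) ≤ 1 / 2 := fun p => by
    have h2 : (2 : ℝ) ≤ ((p : ℕ) : ℝ) := by exact_mod_cast p.2.two_le
    calc ((p : ℕ) : ℝ) ^ (-s) ≤ ((p : ℕ) : ℝ) ^ (-1 : ℝ) :=
          Real.rpow_le_rpow_of_exponent_le (by linarith) (by linarith)
      _ = (((p : ℕ) : ℝ))⁻¹ := Real.rpow_neg_one _
      _ ≤ 2⁻¹ := by gcongr
      _ = 1 / 2 := by norm_num
  have hsx : Summable (fun p : Nat.Primes => ((p : ℕ) : ℝ) ^ (-s)) :=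
    Nat.Primes.summable_rpow.2 (by linarith)
  let F : Nat.Primes × (ℕ × ℕ) → ℝ := fun r =>
    ((ArithmeticFunction.moebius (r.2.1 + 1) : ℝ) / ((r.2.1 : ℝ) + 1)) *
      ((((r.1 : ℕ) : ℝ) ^ (-s)) ^ ((r.2.1 + 1) * (r.2.2 + 1)) / ((r.2.2 : ℝ) + 1))
  have hF : Summable F :=
    Summable.of_norm_bounded (hsx.mul_of_nonneg aux_geom (fun p => hx0 p)
      (fun q => by positivity)) (fun r => aux_bound (((r.1 : ℕ) : ℝ) ^ (-s)) (hx0 r.1) (hx1 r.1) r.2.1 r.2.2)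
  have hT : HasSum F (∑' p : Nat.Primes, (((p : ℕ) : ℝ) ^ (-s))) := by
    have h := hF.hasSum
    have hin : ∀ p : Nat.Primes, HasSum (fun q : ℕ × ℕ => F (p, q)) (((p : ℕ) : ℝ) ^ (-s)) :=
      fun p => aux_inner (((p : ℕ) : ℝ) ^ (-s)) (hx0 p) (hx1 p)
    have h2 := HasSum.prod_fiberwise h hin
    rwa [← h2.tsum_eq] at h
  let e : ℕ × (Nat.Primes × ℕ) ≃ Nat.Primes × (ℕ × ℕ) :=
    { toFun := fun r => (r.2.1, (r.1, r.2.2))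
      invFun := fun r => (r.2.1, (r.1, r.2.2))
      left_inv := fun _ => rfl
      right_inv := fun _ => rfl }
  have hT' := e.hasSum_iff.2 hT
  refine hT'.prod_fiberwise fun k => ?_
  have hk : 1 < ((k : ℝ) + 1) * s := by
    have : (0 : ℝ) ≤ k := by positivity
    nlinarith
  have hfib : Summable (fun c : Nat.Primes × ℕ => (F ∘ e) (k, c)) := hT'.summable.prod_factor k
  have hlog : ∀ p : Nat.Primes, HasSum (fun m : ℕ => (F ∘ e) (k, (p, m)))
      (((ArithmeticFunction.moebius (k + 1) : ℝ) / ((k : ℝ) + 1)) *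
        (-Real.log (1 - ((p : ℕ) : ℝ) ^ (-(((k : ℝ) + 1) * s))))) := fun p => by
    have hy : ((p : ℕ) : ℝ) ^ (-(((k : ℝ) + 1) * s)) = (((p : ℕ) : ℝ) ^ (-s)) ^ (k + 1) := by
      rw [← Real.rpow_mul_natCast (by positivity)]
      congr 1
      push_cast
      ring
    rw [hy]
    have hy1 : |(((p : ℕ) : ℝ) ^ (-s)) ^ (k + 1)| < 1 := by
      rw [abs_of_nonneg (by positivity)]
      exact pow_lt_one₀ (hx0 p) (by linarith [hx1 p]) (by omega)
    refine ((Real.hasSum_pow_div_log_of_abs_lt_one hy1).mul_left _).congr_fun ?_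
    intro m
    simp only [F, e, Function.comp, Equiv.coe_fn_mk]
    rw [pow_mul]
  have h1 := hfib.hasSum
  have h2 := h1.prod_fiberwise hlog
  have h3 := (aux_log_zeta _ hk).mul_left
    ((ArithmeticFunction.moebius (k + 1) : ℝ) / ((k : ℝ) + 1))
  rwa [h2.unique h3] at h1
end
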